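/- Let k ≥ 1 and let S be a permutation-invariant Markov operator on L²(X^k, μ^{⊗k}) satisfying N ∘ S = S ∘ N, where N averages the last coordinate. Define the operator hierarchy S_k := S and S_{i-1} := F_i ∘ S_i ∘ I_i for i = k, k−1, …, 1, where I_i : L²(X^{i-1}, μ^{⊗(i-1)}) → L²(X^i, μ^{⊗i}) is given by (I_i f)(x₁,…,x_i) = f(x₁,…,x_{i-1}) and F_i := I_i*. Then each S_i is a permutation-invariant Markov operator on L²(X^i, μ^{⊗i}); S_i(I_i f) = I_i(S_{i-1} f) and S_i*(I_i f) = I_i(S_{i-1}* f) for every f ∈ L²(X^{i-1}, μ^{⊗(i-1)}) and every i ∈ {1,…,k}; S₀ is the identity on L²(X⁰, μ^{⊗0}) ≅ ℝ; and S_i f ≥ 0 for every f ≥ 0 and every i. -/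

import Mathlib

open MeasureTheory

noncomputable section

/-- The constant-one function as an element of `L²` of a finite measure. -/
noncomputable def lpOne {Z : Type*} [MeasurableSpace Z] (ν : Measure Z)
    [IsFiniteMeasure ν] : Lp ℝ 2 ν :=
  Lp.const 2 ν (1 : ℝ)

/-- A Markov operator on `L²`: positivity-preserving, fixing the constants, with adjoint
fixing the constants. -/
def IsMarkovOp {Z : Type*} [MeasurableSpace Z] (ν : Measure Z) [IsFiniteMeasure ν]
    (S : Lp ℝ 2 ν →L[ℝ] Lp ℝ 2 ν) : Prop :=
  (∀ f : Lp ℝ 2 ν, (0 : Z → ℝ) ≤ᵐ[ν] ⇑f → (0 : Z → ℝ) ≤ᵐ[ν] ⇑(S f)) ∧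
    S (lpOne ν) = lpOne ν ∧
    ContinuousLinearMap.adjoint S (lpOne ν) = lpOne ν

/-- An operator on `L²(X^k, μ^{⊗k})` is permutation invariant if it commutes with the
Koopman operator of every coordinate permutation: whenever `g` is (a.e.) the Koopman image
`f ∘ π` of `f`, then `S g` is the Koopman image of `S f`. -/
def PermInv {X : Type*} [MeasurableSpace X] {k : ℕ} (ν : Measure (Fin k → X))
    (S : Lp ℝ 2 ν →L[ℝ] Lp ℝ 2 ν) : Prop :=
  ∀ (π : Equiv.Perm (Fin k)) (f g : Lp ℝ 2 ν),
    (⇑g =ᵐ[ν] fun x => f (fun i => x (π i))) →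
    (⇑(S g) =ᵐ[ν] fun x => (S f) (fun i => x (π i)))

section helpers18

variable {X : Type*} [MeasurableSpace X] (μ : Measure X) [IsProbabilityMeasure μ]

theorem mpSnoc (n : ℕ) : MeasurePreserving
    (fun z : X × (Fin n → X) => (Fin.snoc (α := fun _ => X) z.2 z.1 : Fin (n + 1) → X))
    (μ.prod (Measure.pi fun _ : Fin n => μ)) (Measure.pi fun _ : Fin (n + 1) => μ) := by
  have h := (measurePreserving_piFinSuccAbove (fun _ : Fin (n + 1) => μ) (Fin.last n)).symm
  convert h using 1
  funext z
  exact (Fin.insertNth_last' z.1 z.2).symm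

theorem mpInit (n : ℕ) : MeasurePreserving
    (fun (x : Fin (n + 1) → X) (j : Fin n) => x j.castSucc)
    (Measure.pi fun _ : Fin (n + 1) => μ) (Measure.pi fun _ : Fin n => μ) := by
  have h := (measurePreserving_snd (μ := μ) (ν := Measure.pi fun _ : Fin n => μ)).comp
    (measurePreserving_piFinSuccAbove (fun _ : Fin (n + 1) => μ) (Fin.last n))
  convert h using 1
  funext x j
  simp [MeasurableEquiv.piFinSuccAbove, Fin.insertNthEquiv, Fin.init]

theorem mpPerm {n : ℕ} (π : Equiv.Perm (Fin n)) : MeasurePreserving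
    (fun (x : Fin n → X) (j : Fin n) => x (π j))
    (Measure.pi fun _ : Fin n => μ) (Measure.pi fun _ : Fin n => μ) := by
  have hm : Measurable (fun (x : Fin n → X) (j : Fin n) => x (π j)) := by fun_prop
  refine ⟨hm, (Measure.pi_eq fun s hs => ?_).symm⟩
  rw [Measure.map_apply hm (MeasurableSet.univ_pi hs)]
  have : (fun (x : Fin n → X) (j : Fin n) => x (π j)) ⁻¹' Set.univ.pi s
      = Set.univ.pi (fun j => s (π.symm j)) := by
    ext x
    simp only [Set.mem_preimage, Set.mem_univ_pi]
    constructor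
    · intro h j
      simpa using h (π.symm j)
    · intro h j
      simpa using h (π j)
  rw [this, Measure.pi_pi]
  exact Equiv.prod_comp π.symm (fun j => μ (s j))

theorem integral_snoc {n : ℕ} {F : (Fin (n + 1) → X) → ℝ}
    (hF : Integrable F (Measure.pi fun _ : Fin (n + 1) => μ)) :
    Integrable (fun x : Fin n → X => ∫ z, F (Fin.snoc (α := fun _ => X) x z) ∂μ)
      (Measure.pi fun _ : Fin n => μ) ∧
    ∫ w, F w ∂(Measure.pi fun _ : Fin (n + 1) => μ) =
      ∫ x, ∫ z, F (Fin.snoc (α := fun _ => X) x z) ∂μ ∂(Measure.pi fun _ : Fin n => μ) := by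
  have hc := (mpSnoc μ n).integrable_comp_of_integrable hF
  refine ⟨hc.integral_prod_right, ?_⟩
  rw [← (mpSnoc μ n).map_eq, integral_map (mpSnoc μ n).measurable.aemeasurable]
  · exact integral_prod_symm _ hc
  · rw [(mpSnoc μ n).map_eq]; exact hF.1

/-- Koopman operator. -/
def koop {n : ℕ} (π : Equiv.Perm (Fin n)) :
    Lp ℝ 2 (Measure.pi fun _ : Fin n => μ) →L[ℝ] Lp ℝ 2 (Measure.pi fun _ : Fin n => μ) :=
  (Lp.compMeasurePreservingₗᵢ ℝ _ (mpPerm μ π)).toContinuousLinearMap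

theorem koop_coe {n : ℕ} (π : Equiv.Perm (Fin n))
    (f : Lp ℝ 2 (Measure.pi fun _ : Fin n => μ)) :
    koop μ π f =ᵐ[Measure.pi fun _ : Fin n => μ] fun x => f (fun i => x (π i)) :=
  Lp.coeFn_compMeasurePreserving f (mpPerm μ π)

theorem permInv_iff {n : ℕ}
    (S : Lp ℝ 2 (Measure.pi fun _ : Fin n => μ) →L[ℝ] Lp ℝ 2 (Measure.pi fun _ : Fin n => μ)) :
    PermInv (Measure.pi fun _ : Fin n => μ) S ↔
      ∀ π f, S (koop μ π f) = koop μ π (S f) := by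
  constructor
  · intro h π f
    exact Lp.ext ((h π f _ (koop_coe μ π f)).trans (koop_coe μ π (S f)).symm)
  · intro h π f g hg
    have : g = koop μ π f := Lp.ext (hg.trans (koop_coe μ π f).symm)
    rw [this, h]
    exact koop_coe μ π (S f)

/-- The inclusion operator. -/
def incl (n : ℕ) : Lp ℝ 2 (Measure.pi fun _ : Fin n => μ) →L[ℝ]
      Lp ℝ 2 (Measure.pi fun _ : Fin (n + 1) => μ) :=
  (Lp.compMeasurePreservingₗᵢ ℝ _ (mpInit μ n)).toContinuousLinearMap

theorem incl_coe {n : ℕ} (f : Lp ℝ 2 (Measure.pi fun _ : Fin n => μ)) :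
    incl μ n f =ᵐ[Measure.pi fun _ : Fin (n + 1) => μ]
      fun x => f (fun i : Fin n => x i.castSucc) :=
  Lp.coeFn_compMeasurePreserving f (mpInit μ n)

theorem adj_incl_incl {n : ℕ} (f : Lp ℝ 2 (Measure.pi fun _ : Fin n => μ)) :
    ContinuousLinearMap.adjoint (incl μ n) (incl μ n f) = f := by
  refine ext_inner_right ℝ fun g => ?_
  rw [ContinuousLinearMap.adjoint_inner_left]
  exact (Lp.compMeasurePreservingₗᵢ ℝ _ (mpInit μ n)).inner_map_map f g

theorem incl_inj {n : ℕ} : Function.Injective (incl μ n) := fun f g h => by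
  rw [← adj_incl_incl μ f, h, adj_incl_incl]

theorem incl_one (n : ℕ) : incl μ n (lpOne _) = lpOne _ := by
  refine Lp.ext ?_
  have h1 : lpOne (Measure.pi fun _ : Fin n => μ) =ᵐ[Measure.pi fun _ : Fin n => μ]
    fun _ => (1 : ℝ) := Lp.coeFn_const ..
  have h2 : lpOne (Measure.pi fun _ : Fin (n + 1) => μ)
    =ᵐ[Measure.pi fun _ : Fin (n + 1) => μ] fun _ => (1 : ℝ) := Lp.coeFn_const ..
  have h3 := (mpInit μ n).quasiMeasurePreserving.ae h1
  filter_upwards [incl_coe μ (lpOne (Measure.pi fun _ : Fin n => μ)), h2, h3] with x a b c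
  rw [a, b, c]

theorem incl_nonneg {n : ℕ} (f : Lp ℝ 2 (Measure.pi fun _ : Fin n => μ)) :
    (0 : (Fin (n + 1) → X) → ℝ) ≤ᵐ[Measure.pi fun _ : Fin (n + 1) => μ] ⇑(incl μ n f) ↔
    (0 : (Fin n → X) → ℝ) ≤ᵐ[Measure.pi fun _ : Fin n => μ] ⇑f := by
  constructor
  · intro h
    have hs : MeasurableSet {x | (0 : ℝ) ≤ f x} :=
      measurableSet_le measurable_const (Lp.stronglyMeasurable f).measurable
    have := (ae_map_iff (mpInit μ n).measurable.aemeasurable (p := fun x => (0 : ℝ) ≤ f x) hs).2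
      (by
        filter_upwards [h, incl_coe μ f] with x a b
        rw [b] at a
        exact a)
    rw [(mpInit μ n).map_eq] at this
    exact this
  · intro h
    filter_upwards [(mpInit μ n).quasiMeasurePreserving.ae h, incl_coe μ f] with x a b
    rw [b]
    exact a

theorem adj_incl_coe {n : ℕ} (f : Lp ℝ 2 (Measure.pi fun _ : Fin (n + 1) => μ)) :
    (fun x : Fin n → X => ∫ z, f (Fin.snoc (α := fun _ => X) x z) ∂μ)
      =ᵐ[Measure.pi fun _ : Fin n => μ] ContinuousLinearMap.adjoint (incl μ n) f := by
  have hf : Integrable f (Measure.pi fun _ : Fin (n + 1) => μ) :=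
    (Lp.memLp f).integrable (by norm_num)
  refine Integrable.ae_eq_of_forall_setIntegral_eq _ _ (integral_snoc μ hf).1
    ((Lp.memLp _).integrable (by norm_num)) fun s hs hμs => ?_
  rw [← L2.inner_indicatorConstLp_one (𝕜 := ℝ) hs hμs.ne,
    ContinuousLinearMap.adjoint_inner_right, L2.inner_def]
  have hs' : MeasurableSet ((fun (x : Fin (n + 1) → X) (j : Fin n) => x j.castSucc) ⁻¹' s) :=
    (mpInit μ n).measurable hs
  have e : ∫ a, inner ℝ ((incl μ n (indicatorConstLp 2 hs hμs.ne (1 : ℝ))) a) (f a)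
        ∂(Measure.pi fun _ : Fin (n + 1) => μ)
      = ∫ a, ((fun (x : Fin (n + 1) → X) (j : Fin n) => x j.castSucc) ⁻¹' s).indicator f a
        ∂(Measure.pi fun _ : Fin (n + 1) => μ) := by
    refine integral_congr_ae ?_
    filter_upwards [incl_coe μ (indicatorConstLp 2 hs hμs.ne (1 : ℝ)),
      (mpInit μ n).quasiMeasurePreserving.ae
        (indicatorConstLp_coeFn (p := 2) (hs := hs) (hμs := hμs.ne) (c := (1 : ℝ)))] with x a b
    rw [a, b]
    by_cases hx : (fun j : Fin n => x j.castSucc) ∈ s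
    · simp [Set.indicator, hx]
    · simp [Set.indicator, hx]
  rw [e, (integral_snoc μ (hf.indicator hs')).2, ← integral_indicator hs]
  refine integral_congr_ae (Filter.Eventually.of_forall fun x => ?_)
  by_cases hx : x ∈ s
  · simp [Set.indicator, hx]
  · simp [Set.indicator, hx]

/-- Averaging via swapping the last two coordinates. -/
theorem adj_koop_incl {n : ℕ} (f : Lp ℝ 2 (Measure.pi fun _ : Fin (n + 1) => μ)) :
    ContinuousLinearMap.adjoint (incl μ (n + 1))
      (koop μ (Equiv.swap (Fin.last (n + 1)) (Fin.last n).castSucc) (incl μ (n + 1) f)) =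
    incl μ n (ContinuousLinearMap.adjoint (incl μ n) f) := by
  set τ : Equiv.Perm (Fin (n + 2)) := Equiv.swap (Fin.last (n + 1)) (Fin.last n).castSucc with hτ
  refine Lp.ext ((adj_incl_coe μ _).symm.trans ?_)
  have h1 : koop μ τ (incl μ (n + 1) f) =ᵐ[Measure.pi fun _ : Fin (n + 2) => μ]
      fun x => f (fun i => x (τ i.castSucc)) := by
    filter_upwards [koop_coe μ τ (incl μ (n + 1) f),
      (mpPerm μ τ).quasiMeasurePreserving.ae (incl_coe μ f)] with x a b
    rw [a, b]
  have h2 := (mpSnoc μ (n + 1)).quasiMeasurePreserving.ae h1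
  have h3 := Measure.ae_ae_of_ae_prod
    ((Measure.measurePreserving_swap (μ := Measure.pi fun _ : Fin (n + 1) => μ)
      (ν := μ)).quasiMeasurePreserving.ae h2)
  filter_upwards [h3, incl_coe μ (ContinuousLinearMap.adjoint (incl μ n) f),
    (mpInit μ n).quasiMeasurePreserving.ae (adj_incl_coe μ f)] with u a b c
  rw [b, ← c]
  refine integral_congr_ae ?_
  filter_upwards [a] with z hz
  simp only [Prod.swap] at hz
  rw [hz]
  congr 1
  funext i
  refine Fin.lastCases ?_ (fun j => ?_) i
  · simp [hτ]
  · have h1 : (j.castSucc.castSucc : Fin (n + 2)) ≠ Fin.last (n + 1) := Fin.castSucc_ne_last _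
    have h2 : (j.castSucc.castSucc : Fin (n + 2)) ≠ (Fin.last n).castSucc := fun h =>
      Fin.castSucc_ne_last j (Fin.castSucc_injective _ h)
    simp [hτ, Equiv.swap_apply_of_ne_of_ne h1 h2]

/-- Extend a permutation by fixing the last point. -/
theorem exists_ext_perm {n : ℕ} (π : Equiv.Perm (Fin n)) :
    ∃ σ : Equiv.Perm (Fin (n + 1)), ∀ j : Fin n, σ j.castSucc = (π j).castSucc := by
  refine ⟨⟨fun i => Fin.lastCases (Fin.last n) (fun j => (π j).castSucc) i,
    fun i => Fin.lastCases (Fin.last n) (fun j => (π.symm j).castSucc) i, ?_, ?_⟩, ?_⟩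
  · intro i
    refine Fin.lastCases ?_ (fun j => ?_) i <;> simp
  · intro i
    refine Fin.lastCases ?_ (fun j => ?_) i <;> simp
  · intro j
    simp

theorem koop_incl {n : ℕ} (π : Equiv.Perm (Fin n)) (σ : Equiv.Perm (Fin (n + 1)))
    (h : ∀ j : Fin n, σ j.castSucc = (π j).castSucc)
    (f : Lp ℝ 2 (Measure.pi fun _ : Fin n => μ)) :
    koop μ σ (incl μ n f) = incl μ n (koop μ π f) := by
  refine Lp.ext ?_
  filter_upwards [koop_coe μ σ (incl μ n f),
    (mpPerm μ σ).quasiMeasurePreserving.ae (incl_coe μ f), incl_coe μ (koop μ π f),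
    (mpInit μ n).quasiMeasurePreserving.ae (koop_coe μ π f)] with x a b c d
  rw [a, b, c, d]
  simp only [h]

/-- One step down: intertwining. -/
theorem step_intertwine {n : ℕ}
    {S : Lp ℝ 2 (Measure.pi fun _ : Fin (n + 1) => μ) →L[ℝ]
      Lp ℝ 2 (Measure.pi fun _ : Fin (n + 1) => μ)}
    {R : Lp ℝ 2 (Measure.pi fun _ : Fin n => μ) →L[ℝ] Lp ℝ 2 (Measure.pi fun _ : Fin n => μ)}
    (hR : R = ContinuousLinearMap.adjoint (incl μ n) ∘L S ∘L incl μ n)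
    (hN : ∀ f, incl μ n (ContinuousLinearMap.adjoint (incl μ n) (S f)) =
      S (incl μ n (ContinuousLinearMap.adjoint (incl μ n) f))) :
    (∀ f, S (incl μ n f) = incl μ n (R f)) ∧
    (∀ f, ContinuousLinearMap.adjoint (incl μ n) (S f) =
      R (ContinuousLinearMap.adjoint (incl μ n) f)) ∧
    (∀ f, ContinuousLinearMap.adjoint S (incl μ n f) =
      incl μ n (ContinuousLinearMap.adjoint R f)) := by
  have h2 : ∀ f, ContinuousLinearMap.adjoint (incl μ n) (S f) =
      R (ContinuousLinearMap.adjoint (incl μ n) f) := by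
    intro f
    rw [hR]
    simp only [ContinuousLinearMap.comp_apply]
    rw [← hN, adj_incl_incl]
  refine ⟨fun f => ?_, h2, fun f => ?_⟩
  · rw [hR]
    simp only [ContinuousLinearMap.comp_apply]
    rw [hN, adj_incl_incl]
  · refine ext_inner_right ℝ fun g => ?_
    rw [ContinuousLinearMap.adjoint_inner_left, ← ContinuousLinearMap.adjoint_inner_right,
      h2, ← ContinuousLinearMap.adjoint_inner_left, ContinuousLinearMap.adjoint_inner_right]

theorem step_markov {n : ℕ}
    {S : Lp ℝ 2 (Measure.pi fun _ : Fin (n + 1) => μ) →L[ℝ]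
      Lp ℝ 2 (Measure.pi fun _ : Fin (n + 1) => μ)}
    {R : Lp ℝ 2 (Measure.pi fun _ : Fin n => μ) →L[ℝ] Lp ℝ 2 (Measure.pi fun _ : Fin n => μ)}
    (h1 : ∀ f, S (incl μ n f) = incl μ n (R f))
    (h3 : ∀ f, ContinuousLinearMap.adjoint S (incl μ n f) =
      incl μ n (ContinuousLinearMap.adjoint R f))
    (hM : IsMarkovOp _ S) (hP : PermInv _ S) :
    IsMarkovOp _ R ∧ PermInv _ R := by
  obtain ⟨hp, hone, hone'⟩ := hM
  refine ⟨⟨fun f hf => ?_, incl_inj μ ?_, incl_inj μ ?_⟩, ?_⟩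
  · rw [← incl_nonneg, ← h1]
    exact hp _ ((incl_nonneg μ f).2 hf)
  · rw [← h1, incl_one, hone]
  · rw [← h3, incl_one, hone']
  · rw [permInv_iff] at hP ⊢
    intro π f
    obtain ⟨σ, hσ⟩ := exists_ext_perm π
    apply incl_inj μ
    rw [← h1, ← koop_incl μ π σ hσ, hP, h1, koop_incl μ π σ hσ]

theorem step_comm {n : ℕ}
    {S : Lp ℝ 2 (Measure.pi fun _ : Fin (n + 2) => μ) →L[ℝ]
      Lp ℝ 2 (Measure.pi fun _ : Fin (n + 2) => μ)}
    {R : Lp ℝ 2 (Measure.pi fun _ : Fin (n + 1) => μ) →L[ℝ]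
      Lp ℝ 2 (Measure.pi fun _ : Fin (n + 1) => μ)}
    (h1 : ∀ f, S (incl μ (n + 1) f) = incl μ (n + 1) (R f))
    (h2 : ∀ f, ContinuousLinearMap.adjoint (incl μ (n + 1)) (S f) =
      R (ContinuousLinearMap.adjoint (incl μ (n + 1)) f))
    (hP : PermInv _ S) (f : Lp ℝ 2 (Measure.pi fun _ : Fin (n + 1) => μ)) :
    incl μ n (ContinuousLinearMap.adjoint (incl μ n) (R f)) =
      R (incl μ n (ContinuousLinearMap.adjoint (incl μ n) f)) := by
  rw [permInv_iff] at hP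
  rw [← adj_koop_incl, ← adj_koop_incl, ← h2, hP, h1]

theorem eq_id_zero (R : Lp ℝ 2 (Measure.pi fun _ : Fin 0 => μ) →L[ℝ]
    Lp ℝ 2 (Measure.pi fun _ : Fin 0 => μ)) (hR : R (lpOne _) = lpOne _) :
    R = ContinuousLinearMap.id ℝ (Lp ℝ 2 (Measure.pi fun _ : Fin 0 => μ)) := by
  ext1 f
  have hf : f = (f default) • lpOne (Measure.pi fun _ : Fin 0 => μ) := by
    refine Lp.ext ?_
    have h1 : lpOne (Measure.pi fun _ : Fin 0 => μ) =ᵐ[Measure.pi fun _ : Fin 0 => μ]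
      fun _ => (1 : ℝ) := Lp.coeFn_const ..
    filter_upwards [h1, Lp.coeFn_smul (f default) (lpOne (Measure.pi fun _ : Fin 0 => μ))]
      with x a b
    rw [b, Pi.smul_apply, a, Subsingleton.elim x default]
    simp
  rw [hf, map_smul, hR]
  rfl

end helpers18

/-- (Here `k = m + 1 ≥ 1`.)  Let `S` be a permutation-invariant Markov
operator on `L²(X^k, μ^{⊗k})` commuting with the operator `N = I_k ∘ I_k*` averaging out
the last coordinate, where `I_{i+1} : L²(X^i) → L²(X^{i+1})` denotes the operator ignoring
the last coordinate.  Let `(S_i)_{i ≤ k}` be the operator hierarchy defined by `S_k := S`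
and `S_{i-1} := I_i* ∘ S_i ∘ I_i`.  Then every `S_i` is a permutation-invariant Markov
operator; `S_i ∘ I_i = I_i ∘ S_{i-1}` and `S_i* ∘ I_i = I_i ∘ S_{i-1}*`; `S₀` is the
identity on `L²(X⁰) ≅ ℝ`; and each `S_i` is positivity-preserving. -/
theorem stmt18 {X : Type*} [MeasurableSpace X] (μ : Measure X) [IsProbabilityMeasure μ]
    (m : ℕ)
    (I : ∀ i : ℕ, Lp ℝ 2 (Measure.pi fun _ : Fin i => μ) →L[ℝ]
      Lp ℝ 2 (Measure.pi fun _ : Fin (i + 1) => μ))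
    (hI : ∀ (i : ℕ) (f : Lp ℝ 2 (Measure.pi fun _ : Fin i => μ)),
      ⇑(I i f) =ᵐ[Measure.pi fun _ : Fin (i + 1) => μ]
        fun x => f (fun j : Fin i => x j.castSucc))
    (S : Lp ℝ 2 (Measure.pi fun _ : Fin (m + 1) => μ) →L[ℝ]
      Lp ℝ 2 (Measure.pi fun _ : Fin (m + 1) => μ))
    (hSM : IsMarkovOp (Measure.pi fun _ : Fin (m + 1) => μ) S)
    (hSP : PermInv (Measure.pi fun _ : Fin (m + 1) => μ) S)
    (hN : (I m ∘L ContinuousLinearMap.adjoint (I m)) ∘L S =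
      S ∘L (I m ∘L ContinuousLinearMap.adjoint (I m)))
    (Sh : ∀ i : ℕ, Lp ℝ 2 (Measure.pi fun _ : Fin i => μ) →L[ℝ]
      Lp ℝ 2 (Measure.pi fun _ : Fin i => μ))
    (hShTop : Sh (m + 1) = S)
    (hShStep : ∀ i : ℕ, i ≤ m →
      Sh i = ContinuousLinearMap.adjoint (I i) ∘L Sh (i + 1) ∘L I i) :
    (∀ i : ℕ, i ≤ m + 1 →
      IsMarkovOp (Measure.pi fun _ : Fin i => μ) (Sh i) ∧
        PermInv (Measure.pi fun _ : Fin i => μ) (Sh i)) ∧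
    (∀ i : ℕ, i ≤ m →
      Sh (i + 1) ∘L I i = I i ∘L Sh i ∧
        ContinuousLinearMap.adjoint (Sh (i + 1)) ∘L I i =
          I i ∘L ContinuousLinearMap.adjoint (Sh i)) ∧
    Sh 0 = ContinuousLinearMap.id ℝ (Lp ℝ 2 (Measure.pi fun _ : Fin 0 => μ)) ∧
    (∀ i : ℕ, i ≤ m + 1 → ∀ f : Lp ℝ 2 (Measure.pi fun _ : Fin i => μ),
      (0 : (Fin i → X) → ℝ) ≤ᵐ[Measure.pi fun _ : Fin i => μ] ⇑f →
      (0 : (Fin i → X) → ℝ) ≤ᵐ[Measure.pi fun _ : Fin i => μ] ⇑(Sh i f)) := by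
  have hI' : ∀ i, I i = incl μ i := fun i =>
    ContinuousLinearMap.ext fun f => Lp.ext ((hI i f).trans (incl_coe μ f).symm)
  simp only [hI'] at hN hShStep ⊢
  have key : ∀ i, i ≤ m → (IsMarkovOp _ (Sh (i + 1)) ∧ PermInv _ (Sh (i + 1)) ∧
      ∀ f, incl μ i (ContinuousLinearMap.adjoint (incl μ i) (Sh (i + 1) f)) =
        Sh (i + 1) (incl μ i (ContinuousLinearMap.adjoint (incl μ i) f))) := by
    intro i hi
    induction hi using Nat.decreasingInduction with
    | self =>
      rw [hShTop]
      exact ⟨hSM, hSP, fun f => DFunLike.congr_fun hN f⟩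
    | of_succ k hk ih =>
      obtain ⟨hM, hP, hC⟩ := ih
      obtain ⟨h1, h2, h3⟩ := step_intertwine μ (hShStep (k + 1) hk) hC
      obtain ⟨hM', hP'⟩ := step_markov μ h1 h3 hM hP
      exact ⟨hM', hP', step_comm μ h1 h2 hP⟩
  have inter := fun i (hi : i ≤ m) => step_intertwine μ (hShStep i hi) (key i hi).2.2
  have all : ∀ i : ℕ, i ≤ m + 1 →
      IsMarkovOp (Measure.pi fun _ : Fin i => μ) (Sh i) ∧
        PermInv (Measure.pi fun _ : Fin i => μ) (Sh i) := by
    intro i hi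
    rcases Nat.lt_or_ge m i with h | h
    · obtain rfl : i = m + 1 := by omega
      rw [hShTop]
      exact ⟨hSM, hSP⟩
    · exact step_markov μ (inter i h).1 (inter i h).2.2 (key i h).1 (key i h).2.1
  refine ⟨all, fun i hi => ⟨ContinuousLinearMap.ext (inter i hi).1,
    ContinuousLinearMap.ext (inter i hi).2.2⟩, eq_id_zero μ _ (all 0 (Nat.zero_le _)).1.2.1,
    fun i hi => (all i hi).1.1⟩
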